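/- With notation as above, for each m ≥ 1 the quotient of the divided power polynomial algebra A_inf(R'_∞)[Tⁿ/n!]_{n≥1} by its subalgebra A_inf(R'_∞)[Tⁿ/n!]_{m≥n≥1} has no nonzero (T − ξ)-torsion, and hence A_cris^{0,(m)}(R'_∞) ≅ (A_inf(R'_∞)[Tⁿ/n!]_{m≥n≥1})/(T − ξ) ≅ A_inf(R'_∞) ⊗_{A_inf} A_cris^{0,(m)}. -/

import Mathlib

open scoped TensorProduct

set_option maxHeartbeats 1000000
set_option synthInstance.maxHeartbeats 400000

/-!
STATEMENT 8. With notation as in Statement 7, for each `m ≥ 1` the quotient of the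
divided power polynomial algebra `A[Tⁿ/n!]_{n≥1}` by its subalgebra
`A[Tⁿ/n!]_{m≥n≥1}` has no nonzero `(T − ξ)`-torsion, and hence
`A_cris^{0,(m)}(R'_∞) ≅ (A[Tⁿ/n!]_{m≥n≥1})/(T − ξ) ≅ A ⊗_{A₀} A_cris^{0,(m)}`,
where `A_cris^{0,(m)}(R'_∞)` is the `A`-subalgebra of `A[1/p]` generated by the
`ξⁿ/n!` for `n ≤ m`.

Setting as in Statement 7: `A₀ = A_inf`, `A = A_inf(R'_∞)`, `L = A[1/p]`,
`L₀ = A₀[1/p]`, `(p, ξ)` regular on `A`.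
-/

/-- Divided power monomials `c · Tⁿ` with `n! · c = 1`, of degree `≤ m` (`m = 0` is
interpreted as no truncation). -/
def dpMonomialsUpTo (L : Type*) [CommRing L] (m : ℕ) : Set (Polynomial L) :=
  {f | ∃ (n : ℕ) (c : L), n ≤ m ∧ (n.factorial : L) * c = 1 ∧
    f = Polynomial.C c * Polynomial.X ^ n}

/-- The full divided power polynomial algebra `A[Tⁿ/n!]_{n≥1}` inside `L[T]`. -/
noncomputable def dpPolyAlgebra (A L : Type*) [CommRing A] [CommRing L] [Algebra A L] :
    Subalgebra A (Polynomial L) :=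
  Algebra.adjoin A
    {f | ∃ (n : ℕ) (c : L), (n.factorial : L) * c = 1 ∧
      f = Polynomial.C c * Polynomial.X ^ n}

/-- The truncated divided power polynomial algebra `A[Tⁿ/n!]_{m≥n≥1}` inside `L[T]`. -/
noncomputable def dpPolyAlgebraTrunc (A L : Type*) [CommRing A] [CommRing L]
    [Algebra A L] (m : ℕ) : Subalgebra A (Polynomial L) :=
  Algebra.adjoin A (dpMonomialsUpTo L m)

/-- `A_cris^{0,(m)}`: the `A`-subalgebra of `L = A[1/p]` generated by the divided
powers `ζⁿ/n!` for `1 ≤ n ≤ m`. -/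
noncomputable def acrisZeroTrunc (A L : Type*) [CommRing A] [CommRing L] [Algebra A L]
    (ζ : A) (m : ℕ) : Subalgebra A L :=
  Algebra.adjoin A
    {x | ∃ n : ℕ, 1 ≤ n ∧ n ≤ m ∧ (n.factorial : L) * x = (algebraMap A L ζ) ^ n}

namespace TruncDP

open Polynomial

/-- `Den m N d`: `d` is a product of factorials `nᵢ!` with `nᵢ ≤ m` and `∑ nᵢ = N`. -/
inductive Den (m : ℕ) : ℕ → ℕ → Prop
  | one : Den m 0 1
  | step (n N d : ℕ) : n ≤ m → Den m N d → Den m (n + N) (n.factorial * d)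

theorem Den.mul {m N d : ℕ} (h : Den m N d) {M e : ℕ} (h' : Den m M e) :
    Den m (N + M) (d * e) := by
  induction h with
  | one => simpa using h'
  | step n N d hn _ ih =>
    rw [add_assoc, mul_assoc]
    exact Den.step _ _ _ hn ih

theorem Den.dvd {m N d : ℕ} (h : Den m N d) : d ∣ N.factorial := by
  induction h with
  | one => simp
  | step n N d hn _ ih =>
    exact (mul_dvd_mul_left _ ih).trans (Nat.factorial_mul_factorial_dvd_factorial_add n N)

theorem Den.ne_zero {m N d : ℕ} (h : Den m N d) : d ≠ 0 := by
  rintro rfl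
  exact Nat.factorial_ne_zero N (zero_dvd_iff.mp h.dvd)

theorem Den.single {m n : ℕ} (h : n ≤ m) : Den m n n.factorial := by
  simpa using Den.step n 0 1 h Den.one

theorem Den.exists_one {m : ℕ} (hm : 1 ≤ m) (N : ℕ) : Den m N 1 := by
  induction N with
  | zero => exact Den.one
  | succ N ih => simpa [add_comm] using Den.step 1 N 1 hm ih

theorem exists_max (p m : ℕ) [Fact p.Prime] (hm : 1 ≤ m) :
    ∃ d : ℕ → ℕ, ∀ N, Den m N (d N) ∧
      ∀ e, Den m N e → padicValNat p e ≤ padicValNat p (d N) := by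
  have key : ∀ N, ∃ d, Den m N d ∧ ∀ e, Den m N e → padicValNat p e ≤ padicValNat p d := by
    intro N
    have hfin : {d | Den m N d}.Finite :=
      (Nat.divisors N.factorial).finite_toSet.subset (fun d hd => by
        simpa using ⟨Den.dvd hd, Nat.factorial_ne_zero N⟩)
    obtain ⟨d, hd, hmax⟩ := Set.exists_max_image _ (padicValNat p) hfin ⟨1, Den.exists_one hm N⟩
    exact ⟨d, hd, hmax⟩
  choose d hd using key
  exact ⟨d, hd⟩

section
variable {A L : Type*} [CommRing A] [CommRing L] [Algebra A L] (p : ℕ) [Fact p.Prime]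
  [IsLocalization.Away (p : A) L]

theorem alg_inj (hptf : ∀ x : A, (p : A) * x = 0 → x = 0) :
    Function.Injective (algebraMap A L) := by
  refine IsLocalization.injective L (M := Submonoid.powers (p : A)) ?_
  rintro _ ⟨k, rfl⟩
  refine pow_mem ?_ k
  rw [mem_nonZeroDivisors_iff_right]
  intro x hx
  exact hptf x (by rw [mul_comm]; exact hx)

theorem exists_pow (x : L) : ∃ (k : ℕ) (a : A), x * (p : L) ^ k = algebraMap A L a := by
  obtain ⟨⟨a, ⟨_, k, rfl⟩⟩, h⟩ := IsLocalization.surj (Submonoid.powers (p : A)) x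
  exact ⟨k, a, by simpa using h⟩

theorem p_unit (A : Type*) {L : Type*} [CommRing A] [CommRing L] [Algebra A L] (p : ℕ)
    [IsLocalization.Away (p : A) L] : IsUnit (p : L) := by
  have := IsLocalization.Away.algebraMap_isUnit (S := L) (p : A)
  simpa using this

theorem divA (hptf : ∀ x : A, (p : A) * x = 0 → x = 0) {d e : ℕ} (hd0 : d ≠ 0)
    (hd : IsUnit (d : L)) (he0 : e ≠ 0) (hv : padicValNat p d ≤ padicValNat p e) :
    ∃ a : A, (e : A) = d * a := by
  have hp : p.Prime := Fact.out
  obtain ⟨v, d', hd', rfl⟩ := Nat.exists_eq_pow_mul_and_not_dvd hd0 p hp.ne_one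
  have hpe : p ^ v ∣ e := by
    have h1 : p ^ v ∣ e ↔ v ≤ padicValNat p e := padicValNat_dvd_iff_le he0
    rw [h1]
    refine le_trans ?_ hv
    exact (padicValNat_dvd_iff_le hd0).mp (dvd_mul_right _ _)
  obtain ⟨e', rfl⟩ := hpe
  have hu : IsUnit (d' : L) := by
    rw [Nat.cast_mul] at hd
    exact isUnit_of_mul_isUnit_right hd
  obtain ⟨y, hy⟩ := hu.exists_right_inv
  obtain ⟨k, a, ha⟩ := exists_pow (A := A) p y
  have h2 : (d' : A) * a = (p : A) ^ k := by
    apply alg_inj (L := L) p hptf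
    rw [map_mul, ← ha]
    simp only [map_natCast, map_pow]
    rw [← mul_assoc, hy, one_mul]
  have hc : IsCoprime (d' : ℤ) ((p ^ k : ℕ) : ℤ) := by
    rw [Nat.isCoprime_iff_coprime]
    exact (Nat.Coprime.pow_right k ((Nat.Prime.coprime_iff_not_dvd hp).mpr hd').symm)
  obtain ⟨u, w, huw⟩ := hc
  have h3 : (u : A) * d' + w * (p : A) ^ k = 1 := by
    have := congrArg (Int.cast : ℤ → A) huw
    push_cast at this
    exact this
  refine ⟨(u + w * a) * e', ?_⟩
  push_cast
  rw [← h2] at h3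
  linear_combination (-(p : A) ^ v * e') * h3

theorem reg_L (hptf : ∀ x : A, (p : A) * x = 0 → x = 0) (r : A)
    (hreg : ∀ x : A, r * x ∈ Ideal.span {(p : A)} → x ∈ Ideal.span {(p : A)}) (x : L)
    (hx : ∃ c, algebraMap A L r * x = algebraMap A L c) : ∃ b, x = algebraMap A L b := by
  obtain ⟨k, a, ha⟩ := exists_pow (A := A) p x
  induction k generalizing x a with
  | zero => exact ⟨a, by simpa using ha⟩
  | succ k ih =>
    obtain ⟨c, hc⟩ := hx
    obtain ⟨b, hb⟩ := ih (x * p) ⟨c * p, by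
      rw [map_mul, ← hc, map_natCast, mul_assoc]⟩ a (by rw [← ha]; ring)
    have h1 : r * b = p * c := by
      apply alg_inj (L := L) p hptf
      rw [map_mul, ← hb, map_mul, ← hc, map_natCast]; ring
    obtain ⟨b', rfl⟩ := Ideal.mem_span_singleton.mp
      (hreg b (Ideal.mem_span_singleton.mpr ⟨c, h1⟩))
    refine ⟨b', (p_unit A (L := L) p).mul_right_cancel ?_⟩
    rw [hb, map_mul, map_natCast, mul_comm]

variable {m : ℕ} {d : ℕ → ℕ}

theorem dunit (hfac : ∀ n : ℕ, IsUnit ((n.factorial : ℕ) : L)) {N e : ℕ} (h : Den m N e) :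
    IsUnit (e : L) := by
  obtain ⟨c, hc⟩ := h.dvd
  have := hfac N
  rw [hc, Nat.cast_mul] at this
  exact isUnit_of_mul_isUnit_left this

theorem Den.monomial_mem {N e : ℕ} (h : Den m N e) :
    ∀ c : L, (hfac : ∀ n : ℕ, IsUnit ((n.factorial : ℕ) : L)) → (e : L) * c = 1 →
    C c * X ^ N ∈ dpPolyAlgebraTrunc A L m := by
  induction h with
  | one =>
    intro c _ hc
    have : c = 1 := by simpa using hc
    subst this
    simpa using one_mem _
  | step n N e hn h ih =>
    intro c hfac hc
    have h1 : C ((e : L) * c) * X ^ n ∈ dpPolyAlgebraTrunc A L m := by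
      refine Algebra.subset_adjoin ⟨n, _, hn, ?_, rfl⟩
      rw [← hc]; push_cast; ring
    have h2 := ih ((n.factorial : L) * c) hfac (by rw [← hc]; push_cast; ring)
    have h3 := mul_mem h1 h2
    convert h3 using 1
    have : C c = C ((e : L) * c) * C ((n.factorial : L) * c) := by
      rw [← C_mul]
      congr 1
      push_cast at hc
      linear_combination (-c) * hc
    rw [this, pow_add]; ring

theorem mem_iff (hptf : ∀ x : A, (p : A) * x = 0 → x = 0)
    (hfac : ∀ n : ℕ, IsUnit ((n.factorial : ℕ) : L))
    (hd : ∀ N, Den m N (d N) ∧ ∀ e, Den m N e → padicValNat p e ≤ padicValNat p (d N))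
    (f : L[X]) :
    f ∈ dpPolyAlgebraTrunc A L m ↔
      ∀ N, ∃ a : A, (d N : L) * f.coeff N = algebraMap A L a := by
  have hdiv : ∀ N e, Den m N e → ∃ a : A, (d N : A) = e * a := fun N e he =>
    divA (L := L) p hptf he.ne_zero (dunit hfac he) (hd N).1.ne_zero ((hd N).2 e he)
  constructor
  · intro hf
    refine Algebra.adjoin_induction (p := fun f _ => ∀ N, ∃ a : A,
      (d N : L) * f.coeff N = algebraMap A L a) ?_ ?_ ?_ ?_ hf
    · rintro _ ⟨n, c, hn, hc, rfl⟩ N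
      rw [coeff_C_mul, coeff_X_pow]
      split_ifs with h
      · subst h
        obtain ⟨a, ha⟩ := hdiv N _ (Den.single hn)
        refine ⟨a, ?_⟩
        have := congrArg (algebraMap A L) ha
        simp only [map_natCast, map_mul] at this
        rw [this]
        linear_combination (algebraMap A L a) * hc
      · exact ⟨0, by simp⟩
    · intro r N
      rw [Polynomial.algebraMap_apply, coeff_C]
      split_ifs with h
      · exact ⟨d N * r, by simp⟩
      · exact ⟨0, by simp⟩
    · intro x y _ _ hx hy N
      obtain ⟨a, ha⟩ := hx N
      obtain ⟨b, hb⟩ := hy N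
      exact ⟨a + b, by rw [coeff_add, mul_add, ha, hb, map_add]⟩
    · intro x y _ _ hx hy N
      rw [coeff_mul, Finset.mul_sum]
      choose a ha using hx
      choose b hb using hy
      have : ∀ ij : ℕ × ℕ, ∃ c : A, ij ∈ Finset.HasAntidiagonal.antidiagonal N →
          (d N : L) * (x.coeff ij.1 * y.coeff ij.2) = algebraMap A L c := by
        rintro ⟨i, j⟩
        by_cases hij : (i, j) ∈ Finset.HasAntidiagonal.antidiagonal N
        · obtain rfl := Finset.HasAntidiagonal.mem_antidiagonal.mp hij
          obtain ⟨c, hc⟩ := hdiv _ _ ((hd i).1.mul (hd j).1)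
          refine ⟨a i * b j * c, fun _ => ?_⟩
          have := congrArg (algebraMap A L) hc
          simp only [map_natCast, map_mul, Nat.cast_mul] at this
          simp only [map_mul, ← ha, ← hb] at this ⊢
          rw [this]; ring
        · exact ⟨0, fun h => absurd h hij⟩
      choose c hc using this
      exact ⟨∑ ij ∈ Finset.HasAntidiagonal.antidiagonal N, c ij, by
        rw [map_sum]; exact Finset.sum_congr rfl hc⟩
  · intro h
    rw [f.as_sum_range_C_mul_X_pow]
    refine sum_mem fun N _ => ?_
    obtain ⟨a, ha⟩ := h N
    obtain ⟨u, hu⟩ := (dunit hfac (hd N).1).exists_right_inv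
    have h1 := (dpPolyAlgebraTrunc A L m).smul_mem ((hd N).1.monomial_mem (A := A) u hfac hu) a
    convert h1 using 1
    rw [Algebra.smul_def, Polynomial.algebraMap_apply, ← ha, ← mul_assoc, ← C_mul]
    congr 2
    linear_combination (-f.coeff N) * hu

theorem succ_dvd (hptf : ∀ x : A, (p : A) * x = 0 → x = 0)
    (hfac : ∀ n : ℕ, IsUnit ((n.factorial : ℕ) : L)) (hm : 1 ≤ m)
    (hd : ∀ N, Den m N (d N) ∧ ∀ e, Den m N e → padicValNat p e ≤ padicValNat p (d N))
    (N : ℕ) : ∃ a : A, (d (N + 1) : A) = d N * a := by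
  have he : Den m (N + 1) (d N) := by simpa using (hd N).1.mul (Den.exists_one hm 1)
  exact divA (L := L) p hptf he.ne_zero (dunit hfac he) (hd (N + 1)).1.ne_zero ((hd _).2 _ he)

theorem torsionfree (hptf : ∀ x : A, (p : A) * x = 0 → x = 0)
    (hfac : ∀ n : ℕ, IsUnit ((n.factorial : ℕ) : L)) (hm : 1 ≤ m)
    (hd : ∀ N, Den m N (d N) ∧ ∀ e, Den m N e → padicValNat p e ≤ padicValNat p (d N))
    (r : A) (hreg : ∀ x : A, r * x ∈ Ideal.span {(p : A)} → x ∈ Ideal.span {(p : A)})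
    (f : L[X]) (hf : (X - C (algebraMap A L r)) * f ∈ dpPolyAlgebraTrunc A L m) :
    f ∈ dpPolyAlgebraTrunc A L m := by
  rw [mem_iff p hptf hfac hd] at hf ⊢
  intro N
  induction N with
  | zero =>
    obtain ⟨a, ha⟩ := hf 0
    apply reg_L p hptf r hreg
    refine ⟨-a, ?_⟩
    rw [map_neg, ← ha]
    simp
    ring
  | succ N ih =>
    obtain ⟨a, ha⟩ := hf (N + 1)
    obtain ⟨b, hb⟩ := ih
    obtain ⟨c, hc⟩ := succ_dvd (L := L) p hptf hfac hm hd N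
    have hc' := congrArg (algebraMap A L) hc
    simp only [map_natCast, map_mul] at hc'
    apply reg_L p hptf r hreg
    refine ⟨b * c - a, ?_⟩
    rw [map_sub, ← ha, map_mul, ← hb, sub_mul, coeff_sub, coeff_X_mul, coeff_C_mul, hc']
    ring

theorem map_aeval_trunc (r : A) (hfac : ∀ n : ℕ, IsUnit ((n.factorial : ℕ) : L)) :
    (dpPolyAlgebraTrunc A L m).map ((aeval (algebraMap A L r)).restrictScalars A) =
      acrisZeroTrunc A L r m := by
  unfold dpPolyAlgebraTrunc acrisZeroTrunc
  rw [AlgHom.map_adjoin]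
  apply le_antisymm
  · refine Algebra.adjoin_le ?_
    rintro _ ⟨_, ⟨n, c, hn, hc, rfl⟩, rfl⟩
    rcases Nat.eq_zero_or_pos n with rfl | h0
    · have : c = 1 := by simpa using hc
      subst this
      simpa using one_mem _
    · refine Algebra.subset_adjoin ⟨n, h0, hn, ?_⟩
      simp
      linear_combination (algebraMap A L r) ^ n * hc
  · refine Algebra.adjoin_mono ?_
    rintro x ⟨n, h0, hn, hx⟩
    obtain ⟨c, hc⟩ := (hfac n).exists_right_inv
    refine ⟨C c * X ^ n, ⟨n, c, hn, hc, rfl⟩, ?_⟩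
    simp
    rw [← hx]
    linear_combination x * hc

theorem root_iff (hptf : ∀ x : A, (p : A) * x = 0 → x = 0)
    (hfac : ∀ n : ℕ, IsUnit ((n.factorial : ℕ) : L)) (hm : 1 ≤ m)
    (r : A) (hreg : ∀ x : A, r * x ∈ Ideal.span {(p : A)} → x ∈ Ideal.span {(p : A)})
    (f : L[X]) (hf : f ∈ dpPolyAlgebraTrunc A L m) (h0 : aeval (algebraMap A L r) f = 0) :
    ∃ g ∈ dpPolyAlgebraTrunc A L m, f = (X - C (algebraMap A L r)) * g := by
  obtain ⟨d, hd⟩ := exists_max p m hm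
  have : f.IsRoot (algebraMap A L r) := by simpa [IsRoot, coe_aeval_eq_eval] using h0
  obtain ⟨g, rfl⟩ := dvd_iff_isRoot.mpr this
  exact ⟨g, torsionfree p hptf hfac hm hd r hreg g hf, rfl⟩

theorem iso1 (hptf : ∀ x : A, (p : A) * x = 0 → x = 0)
    (hfac : ∀ n : ℕ, IsUnit ((n.factorial : ℕ) : L)) (hm : 1 ≤ m)
    (r : A) (hreg : ∀ x : A, r * x ∈ Ideal.span {(p : A)} → x ∈ Ideal.span {(p : A)})
    (t : dpPolyAlgebraTrunc A L m) (ht : (t : L[X]) = X - C (algebraMap A L r)) :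
    Nonempty ((↥(dpPolyAlgebraTrunc A L m) ⧸ Ideal.span {t}) ≃ₐ[A] ↥(acrisZeroTrunc A L r m)) := by
  let φ : dpPolyAlgebraTrunc A L m →ₐ[A] L :=
    ((aeval (algebraMap A L r)).restrictScalars A).comp (dpPolyAlgebraTrunc A L m).val
  have hr : φ.range = acrisZeroTrunc A L r m := by
    rw [← map_aeval_trunc r hfac, AlgHom.range_comp, Subalgebra.range_val]
  have hk : Ideal.span {t} = RingHom.ker φ := by
    apply le_antisymm
    · rw [Ideal.span_singleton_le_iff_mem, RingHom.mem_ker]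
      simp [φ, ht]
    · rintro ⟨f, hf⟩ h
      obtain ⟨g, hg, hfg⟩ := root_iff p hptf hfac hm r hreg f hf h
      rw [Ideal.mem_span_singleton]
      exact ⟨⟨g, hg⟩, Subtype.ext (by simp [ht, hfg])⟩
  exact ⟨(Ideal.quotientEquivAlgOfEq A hk).trans
    ((Ideal.quotientKerEquivRange φ).trans (Subalgebra.equivOfEq _ _ hr))⟩

end

theorem iso2 {A₀ A : Type*} [CommRing A₀] [CommRing A] [Algebra A₀ A]
    (p : ℕ) [Fact p.Prime] (ξ : A₀) (m : ℕ) (hm : 1 ≤ m)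
    (L₀ : Type*) [CommRing L₀] [Algebra A₀ L₀] [IsLocalization.Away (p : A₀) L₀]
    (L : Type*) [CommRing L] [Algebra A L] [IsLocalization.Away (p : A) L]
    [Algebra A₀ L] [IsScalarTower A₀ A L]
    (hptf0 : ∀ x : A₀, (p : A₀) * x = 0 → x = 0)
    (hptf : ∀ x : A, (p : A) * x = 0 → x = 0)
    (hfac0 : ∀ n : ℕ, IsUnit ((n.factorial : ℕ) : L₀))
    (hfac : ∀ n : ℕ, IsUnit ((n.factorial : ℕ) : L))
    (hreg : ∀ x : A, algebraMap A₀ A ξ * x ∈ Ideal.span {(p : A)} →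
      x ∈ Ideal.span {(p : A)}) :
    Nonempty ((A ⊗[A₀] ↥(acrisZeroTrunc A₀ L₀ ξ m)) ≃ₐ[A]
      ↥(acrisZeroTrunc A L (algebraMap A₀ A ξ) m)) := by
  obtain ⟨d, hd⟩ := exists_max p m hm
  let θ : L₀ →ₐ[A₀] L := IsLocalization.liftAlgHom (M := Submonoid.powers (p : A₀))
    (f := Algebra.ofId A₀ L) (by
      rintro ⟨_, k, rfl⟩
      simpa using (p_unit A (L := L) p).pow k)
  let Φ : A ⊗[A₀] ↥(acrisZeroTrunc A₀ L₀ ξ m) →ₐ[A] L :=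
    Algebra.TensorProduct.lift (Algebra.ofId A L) (θ.comp (acrisZeroTrunc A₀ L₀ ξ m).val)
      (fun _ _ => Commute.all _ _)
  have hΦ : ∀ a b, Φ (a ⊗ₜ b) = algebraMap A L a * θ b := fun a b => by
    simp [Φ, Algebra.ofId_apply]
  have hξ : algebraMap A₀ L ξ = algebraMap A L (algebraMap A₀ A ξ) :=
    IsScalarTower.algebraMap_apply A₀ A L ξ
  have hr : Φ.range = acrisZeroTrunc A L (algebraMap A₀ A ξ) m := by
    apply le_antisymm
    · rintro _ ⟨z, rfl⟩
      have hθ : ∀ b ∈ acrisZeroTrunc A₀ L₀ ξ m,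
          θ b ∈ acrisZeroTrunc A L (algebraMap A₀ A ξ) m := by
        intro b hb
        refine Algebra.adjoin_induction (p := fun b _ =>
          θ b ∈ acrisZeroTrunc A L (algebraMap A₀ A ξ) m) ?_ ?_ ?_ ?_ hb
        · rintro x ⟨n, h0, hn, hx⟩
          refine Algebra.subset_adjoin ⟨n, h0, hn, ?_⟩
          have := congrArg θ hx
          simpa [hξ] using this
        · intro r
          rw [AlgHom.commutes, IsScalarTower.algebraMap_apply A₀ A L]
          exact Subalgebra.algebraMap_mem _ _
        · intro x y _ _ hx hy
          rw [map_add]; exact add_mem hx hy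
        · intro x y _ _ hx hy
          rw [map_mul]; exact mul_mem hx hy
      change Φ z ∈ _
      induction z with
      | zero => rw [map_zero]; exact zero_mem _
      | tmul a b =>
        rw [hΦ]
        exact mul_mem (Subalgebra.algebraMap_mem _ _) (hθ _ b.2)
      | add x y hx hy => rw [map_add]; exact add_mem hx hy
    · refine Algebra.adjoin_le ?_
      rintro x ⟨n, h0, hn, hx⟩
      obtain ⟨c, hc⟩ := (hfac0 n).exists_right_inv
      have hb : c * algebraMap A₀ L₀ ξ ^ n ∈ acrisZeroTrunc A₀ L₀ ξ m :=
        Algebra.subset_adjoin ⟨n, h0, hn, by rw [← mul_assoc, hc, one_mul]⟩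
      refine ⟨1 ⊗ₜ ⟨_, hb⟩, ?_⟩
      change Φ _ = x
      rw [hΦ]
      have hc' := congrArg θ hc
      simp only [map_mul, map_natCast, map_one] at hc'
      simp only [map_mul, map_pow, AlgHom.commutes, map_one, one_mul, hξ, ← hx]
      linear_combination x * hc'
  have hu : ∀ N, ∃ c : L₀, (d N : L₀) * c = 1 := fun N =>
    (dunit hfac0 (hd N).1).exists_right_inv
  choose c hc using hu
  have heB : ∀ N, c N * algebraMap A₀ L₀ ξ ^ N ∈ acrisZeroTrunc A₀ L₀ ξ m := by
    intro N
    rw [← map_aeval_trunc ξ hfac0]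
    exact ⟨C (c N) * X ^ N, (hd N).1.monomial_mem (c N) hfac0 (hc N), by simp⟩
  let e : ℕ → acrisZeroTrunc A₀ L₀ ξ m := fun N => ⟨_, heB N⟩
  have hespan : ∀ b : acrisZeroTrunc A₀ L₀ ξ m, ∃ (n : ℕ) (a : ℕ → A₀),
      b = ∑ N ∈ Finset.range n, a N • e N := by
    rintro ⟨b, hb⟩
    have hb' := hb
    rw [← map_aeval_trunc ξ hfac0] at hb'
    obtain ⟨f, hf, hfb⟩ := hb'
    have hf := (mem_iff p hptf0 hfac0 hd f).mp hf
    choose a ha using hf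
    refine ⟨f.natDegree + 1, a, Subtype.ext ?_⟩
    have hfb' : aeval (algebraMap A₀ L₀ ξ) f = b := hfb
    rw [← (acrisZeroTrunc A₀ L₀ ξ m).coe_val, map_sum]
    simp only [map_smul, Subalgebra.coe_val, e]
    rw [← hfb', aeval_eq_sum_range]
    refine Finset.sum_congr rfl fun N _ => ?_
    rw [Algebra.smul_def, Algebra.smul_def, ← ha]
    simp only [Algebra.algebraMap_self, RingHom.id_apply]
    linear_combination (-f.coeff N * algebraMap A₀ L₀ ξ ^ N) * hc N
  have hzspan : ∀ z : A ⊗[A₀] ↥(acrisZeroTrunc A₀ L₀ ξ m), ∃ (f : ℕ →₀ A),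
      z = f.sum fun N a => a ⊗ₜ e N := by
    intro z
    induction z with
    | zero => exact ⟨0, by simp⟩
    | tmul x b =>
      obtain ⟨n, a, rfl⟩ := hespan b
      refine ⟨∑ N ∈ Finset.range n, Finsupp.single N (a N • x), ?_⟩
      rw [← Finsupp.sum_finsetSum_index (by simp) (by intros; rw [TensorProduct.add_tmul]),
        TensorProduct.tmul_sum]
      refine Finset.sum_congr rfl fun N _ => ?_
      rw [Finsupp.sum_single_index (by simp), TensorProduct.tmul_smul, TensorProduct.smul_tmul']
    | add x y hx hy =>
      obtain ⟨f, rfl⟩ := hx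
      obtain ⟨g, rfl⟩ := hy
      exact ⟨f + g, by
        rw [Finsupp.sum_add_index' (by simp) (by intros; rw [TensorProduct.add_tmul])]⟩
  have hθd : ∀ N, (d N : L) * θ (c N) = 1 := fun N => by
    have := congrArg θ (hc N)
    simpa using this
  have hinj : Function.Injective Φ := by
    rw [injective_iff_map_eq_zero]
    intro z hz
    obtain ⟨f, rfl⟩ := hzspan z
    let F : L[X] := f.sum fun N a => C (algebraMap A L a * θ (c N)) * X ^ N
    have hFc : ∀ N, F.coeff N = algebraMap A L (f N) * θ (c N) := by
      intro N
      simp only [F, Finsupp.sum, finsetSum_coeff, coeff_C_mul, coeff_X_pow]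
      simp +contextual
    have hF : F ∈ dpPolyAlgebraTrunc A L m := by
      rw [mem_iff p hptf hfac hd]
      intro N
      exact ⟨f N, by rw [hFc]; linear_combination (algebraMap A L (f N)) * hθd N⟩
    have hF0 : aeval (algebraMap A L (algebraMap A₀ A ξ)) F = 0 := by
      rw [← hz]
      simp only [F, Finsupp.sum, map_sum, hΦ, e]
      refine Finset.sum_congr rfl fun N _ => ?_
      simp [hξ, mul_assoc]
    obtain ⟨g, hg, hFg⟩ := root_iff p hptf hfac hm _ hreg F hF hF0
    have hg' := (mem_iff p hptf hfac hd g).mp hg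
    choose b hb using hg'
    choose r hr' using succ_dvd (L := L₀) p hptf0 hfac0 hm hd
    have hb0 : ∀ N, g.natDegree < N → b N = 0 := by
      intro N hN
      apply alg_inj (L := L) p hptf
      rw [← hb, coeff_eq_zero_of_natDegree_lt hN]; simp
    have hrA : ∀ N, (d (N + 1) : L) = d N * algebraMap A L (algebraMap A₀ A (r N)) := by
      intro N
      have := congrArg (fun x => algebraMap A L (algebraMap A₀ A x)) (hr' N)
      simpa using this
    have hfd : ∀ N, algebraMap A L (f N) = d N * F.coeff N := fun N => by
      rw [hFc]; linear_combination (-algebraMap A L (f N)) * hθd N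
    have hf0 : f 0 = - (algebraMap A₀ A ξ * b 0) := by
      apply alg_inj (L := L) p hptf
      rw [hfd, hFg, map_neg, map_mul, ← hb]
      simp
      ring
    have hfs : ∀ N, f (N + 1) = b N * algebraMap A₀ A (r N) - algebraMap A₀ A ξ * b (N + 1) := by
      intro N
      apply alg_inj (L := L) p hptf
      rw [hfd, hFg, map_sub, map_mul, map_mul, ← hb, ← hb, sub_mul, coeff_sub, coeff_X_mul,
        coeff_C_mul, mul_sub]
      rw [hrA]
      ring
    have hre : ∀ N, r N • e (N + 1) = ξ • e N := by
      intro N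
      apply Subtype.ext
      have h1 := congrArg (algebraMap A₀ L₀) (hr' N)
      simp only [map_natCast, map_mul] at h1
      have h2 := hc (N + 1)
      rw [h1] at h2
      rw [Subalgebra.coe_smul, Subalgebra.coe_smul, Algebra.smul_def, Algebra.smul_def]
      simp only [e]
      linear_combination (c N * algebraMap A₀ L₀ ξ ^ (N + 1)) * h2 -
        (algebraMap A₀ L₀ (r N) * c (N + 1) * algebraMap A₀ L₀ ξ ^ (N + 1)) * hc N
    have hmv : ∀ (s : A₀) (x : A) N, (algebraMap A₀ A s * x) ⊗ₜ[A₀] e N = x ⊗ₜ[A₀] (s • e N) := by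
      intro s x N
      rw [← Algebra.smul_def, TensorProduct.smul_tmul]
    have htel : ∀ n, ∑ N ∈ Finset.range (n + 1), f N ⊗ₜ[A₀] e N = - (b n ⊗ₜ[A₀] (ξ • e n)) := by
      intro n
      induction n with
      | zero =>
        rw [Finset.sum_range_one, hf0, TensorProduct.neg_tmul, hmv]
      | succ n ih =>
        rw [Finset.sum_range_succ, ih, hfs, TensorProduct.sub_tmul, mul_comm (b n), hmv, hmv, hre]
        abel
    obtain ⟨n, hn⟩ : ∃ n, g.natDegree < n ∧ f.support ⊆ Finset.range (n + 1) := by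
      refine ⟨max (g.natDegree + 1) (f.support.sup id), by simp, ?_⟩
      intro i hi
      have : i ≤ f.support.sup id := Finset.le_sup (f := id) hi
      simp only [Finset.mem_range]
      omega
    rw [Finsupp.sum_of_support_subset f hn.2 _ (by simp), htel, hb0 n hn.1]
    simp
  exact ⟨(AlgEquiv.ofInjective Φ hinj).trans (Subalgebra.equivOfEq _ _ hr)⟩

end TruncDP

theorem truncated_dp_quotient_torsionfree_and_acris_trunc_iso
    {A₀ A : Type*} [CommRing A₀] [CommRing A] [Algebra A₀ A]
    (p : ℕ) [Fact p.Prime] (ξ : A₀) (m : ℕ) (hm : 1 ≤ m)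
    (L₀ : Type*) [CommRing L₀] [Algebra A₀ L₀] [IsLocalization.Away (p : A₀) L₀]
    (L : Type*) [CommRing L] [Algebra A L] [IsLocalization.Away (p : A) L]
    (hptf0 : ∀ x : A₀, (p : A₀) * x = 0 → x = 0)
    (hptf : ∀ x : A, (p : A) * x = 0 → x = 0)
    (hfac0 : ∀ n : ℕ, IsUnit ((n.factorial : ℕ) : L₀))
    (hfac : ∀ n : ℕ, IsUnit ((n.factorial : ℕ) : L))
    (hreg : ∀ x : A, algebraMap A₀ A ξ * x ∈ Ideal.span {(p : A)} →
      x ∈ Ideal.span {(p : A)})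
    (ITm : Ideal ↥(dpPolyAlgebraTrunc A L m))
    (hITm : ITm = Ideal.span
      {⟨Polynomial.X - Polynomial.C (algebraMap A L (algebraMap A₀ A ξ)),
        by
          refine sub_mem ?_ ?_
          · exact Algebra.subset_adjoin ⟨1, 1, hm, by norm_num, by simp⟩
          · exact (dpPolyAlgebraTrunc A L m).algebraMap_mem (algebraMap A₀ A ξ)⟩}) :
    -- no nonzero `(T − ξ)`-torsion in (full dp algebra)/(truncated dp algebra)
    (∀ f : Polynomial L, f ∈ dpPolyAlgebra A L →
      (Polynomial.X - Polynomial.C (algebraMap A L (algebraMap A₀ A ξ))) * f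
        ∈ dpPolyAlgebraTrunc A L m →
      f ∈ dpPolyAlgebraTrunc A L m) ∧
    -- `A_cris^{0,(m)}(R'_∞) ≅ (A[Tⁿ/n!]_{m≥n≥1})/(T − ξ)`
    (Nonempty ((↥(dpPolyAlgebraTrunc A L m) ⧸ ITm) ≃ₐ[A]
        ↥(acrisZeroTrunc A L (algebraMap A₀ A ξ) m))) ∧
    -- `≅ A ⊗_{A₀} A_cris^{0,(m)}`
    (Nonempty ((↥(dpPolyAlgebraTrunc A L m) ⧸ ITm) ≃ₐ[A]
        (A ⊗[A₀] ↥(acrisZeroTrunc A₀ L₀ ξ m)))) := by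
  obtain ⟨d, hd⟩ := TruncDP.exists_max p m hm
  subst hITm
  have h1 := TruncDP.iso1 p hptf hfac hm (algebraMap A₀ A ξ) hreg
    ⟨Polynomial.X - Polynomial.C (algebraMap A L (algebraMap A₀ A ξ)),
        by
          refine sub_mem ?_ ?_
          · exact Algebra.subset_adjoin ⟨1, 1, hm, by norm_num, by simp⟩
          · exact (dpPolyAlgebraTrunc A L m).algebraMap_mem (algebraMap A₀ A ξ)⟩ rfl
  refine ⟨fun f _ hf => TruncDP.torsionfree p hptf hfac hm hd _ hreg f hf, h1, ?_⟩
  letI : Algebra A₀ L := ((algebraMap A L).comp (algebraMap A₀ A)).toAlgebra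
  haveI : IsScalarTower A₀ A L := IsScalarTower.of_algebraMap_eq fun _ => rfl
  obtain ⟨e1⟩ := h1
  obtain ⟨e2⟩ := TruncDP.iso2 p ξ m hm L₀ L hptf0 hptf hfac0 hfac hreg
  exact ⟨e1.trans e2.symm⟩
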